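/- arXiv:2504.00690 — 2 statements merged into one kernel-verified Lean document; each statement's English description precedes it below -/
import Mathlib

section
/- Gaussian norm quantile bound (probability form). Let ξ be a random vector in ℝⁿ (n ≥ 1) distributed according to a multivariate Gaussian distribution with mean μ ∈ ℝⁿ and symmetric positive definite covariance matrix Σ. Then for every q ≥ 0, P(‖ξ‖₂ ≤ ‖μ‖₂ + sqrt(q · λ_max(Σ))) ≥ P(χ²ₙ ≤ q), where χ²ₙ denotes a random variable with the chi-squared distribution with n degrees of freedom (i.e., the Gamma distribution with shape n/2 and rate 1/2), and λ_max(Σ) is the largest eigenvalue of Σ. In particular, the p-quantile of ‖ξ‖₂ is at most ‖μ‖₂ + sqrt(Q_{χ²ₙ}(p) λ_max(Σ)) for every p ∈ (0,1). -/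
open Matrix MeasureTheory

/-- The multivariate Gaussian measure on `ℝⁿ` with mean `μ` and (positive definite)
covariance matrix `S`: the measure with density
`x ↦ ((2π)^n det S)^(-1/2) exp (-½ (x-μ)ᵀ S⁻¹ (x-μ))` with respect to Lebesgue measure. -/
noncomputable def multivariateGaussian {n : ℕ} (μ : Fin n → ℝ)
    (S : Matrix (Fin n) (Fin n) ℝ) : Measure (Fin n → ℝ) :=
  volume.withDensity fun x =>
    ENNReal.ofReal ((Real.sqrt ((2 * Real.pi) ^ n * S.det))⁻¹ *
      Real.exp (-(1 / 2) * ((x - μ) ⬝ᵥ S⁻¹.mulVec (x - μ))))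

section

open Set Module ENNReal

/-- Polar coordinates for the Lebesgue integral of a function of the norm. -/
lemma lintegral_fun_norm_addHaar {E : Type*} [NormedAddCommGroup E] [NormedSpace ℝ E]
    [MeasurableSpace E] [Nontrivial E] (μ : Measure E) [FiniteDimensional ℝ E] [BorelSpace E]
    [μ.IsAddHaarMeasure] {f : ℝ → ℝ≥0∞} (hf : Measurable f) :
    ∫⁻ x, f ‖x‖ ∂μ = finrank ℝ E * μ (Metric.ball 0 1) *
      ∫⁻ y in Ioi (0 : ℝ), ENNReal.ofReal (y ^ (finrank ℝ E - 1)) * f y :=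
  calc
    ∫⁻ x, f ‖x‖ ∂μ = ∫⁻ x : ({(0)}ᶜ : Set E), f ‖x.1‖ ∂(μ.comap (↑)) := by
      rw [lintegral_subtype_comap (measurableSet_singleton _).compl fun x ↦ f ‖x‖,
        restrict_compl_singleton]
    _ = ∫⁻ x, 1 * f x.2 ∂μ.toSphere.prod (.volumeIoiPow (finrank ℝ E - 1)) := by
      simpa using μ.measurePreserving_homeomorphUnitSphereProd.lintegral_comp
        (f := fun x ↦ f x.2) (by fun_prop)
    _ = μ.toSphere univ * ∫⁻ x : Ioi (0 : ℝ), f x ∂.volumeIoiPow (finrank ℝ E - 1) := by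
      rw [lintegral_prod_mul (f := fun _ ↦ 1) (g := fun x : Ioi (0 : ℝ) ↦ f x)
        (by fun_prop) (by fun_prop), lintegral_one]
    _ = _ := by
      rw [Measure.volumeIoiPow, lintegral_withDensity_eq_lintegral_mul _ (by fun_prop)
        (by fun_prop), μ.toSphere_apply_univ, ← lintegral_subtype_comap measurableSet_Ioi]
      rfl

/-- The substitution `t = y ^ 2` in the Lebesgue integral over the positive half-line. -/
lemma lintegral_Ioi_comp_sq (g : ℝ → ℝ≥0∞) :
    ∫⁻ y in Ioi (0 : ℝ), ENNReal.ofReal (2 * y) * g (y ^ 2) = ∫⁻ t in Ioi (0 : ℝ), g t := by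
  have himage : (fun y : ℝ ↦ y ^ 2) '' Ioi 0 = Ioi 0 := by
    ext t
    refine ⟨?_, fun ht ↦ ⟨√t, Real.sqrt_pos.2 ht, Real.sq_sqrt (le_of_lt ht)⟩⟩
    rintro ⟨y, hy, rfl⟩
    exact pow_pos (mem_Ioi.1 hy) 2
  have h := lintegral_image_eq_lintegral_abs_deriv_mul (s := Ioi (0 : ℝ)) (f := fun y ↦ y ^ 2)
    (f' := fun y ↦ 2 * y) measurableSet_Ioi
    (fun y _ ↦ by simpa using (hasDerivAt_pow 2 y).hasDerivWithinAt)
    (fun x hx y hy h ↦ (pow_left_inj₀ (le_of_lt hx) (le_of_lt hy) two_ne_zero).1 h) g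
  rw [himage] at h
  rw [h]
  refine setLIntegral_congr_fun measurableSet_Ioi fun y hy ↦ ?_
  simp only [abs_of_pos (mul_pos two_pos (mem_Ioi.1 hy))]

/-- The Lebesgue integral over `ℝⁿ` of a function of the squared Euclidean norm. -/
lemma lintegral_comp_dotProduct_self {n : ℕ} (hn : 1 ≤ n) {g : ℝ → ℝ≥0∞} (hg : Measurable g) :
    ∫⁻ z : Fin n → ℝ, g (z ⬝ᵥ z) = ENNReal.ofReal (√Real.pi ^ n / Real.Gamma (n / 2)) *
      ∫⁻ t in Ioi (0 : ℝ), ENNReal.ofReal (t ^ ((n : ℝ) / 2 - 1)) * g t := by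
  have : Nonempty (Fin n) := ⟨⟨0, hn⟩⟩
  have hn0 : (0 : ℝ) < n / 2 := by positivity
  calc
    ∫⁻ z : Fin n → ℝ, g (z ⬝ᵥ z) = ∫⁻ z : EuclideanSpace ℝ (Fin n), g (‖z‖ ^ 2) := by
      rw [← (PiLp.volume_preserving_ofLp (Fin n)).lintegral_comp (f := fun z ↦ g (z ⬝ᵥ z))
        (hg.comp (by unfold dotProduct; fun_prop))]
      refine lintegral_congr fun z ↦ ?_
      rw [EuclideanSpace.real_norm_sq_eq]
      simp [dotProduct, sq]
    _ = n * ENNReal.ofReal (√Real.pi ^ n / Real.Gamma (n / 2 + 1)) *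
        ∫⁻ y in Ioi (0 : ℝ), ENNReal.ofReal (y ^ (n - 1)) * g (y ^ 2) := by
      rw [lintegral_fun_norm_addHaar volume (f := fun y ↦ g (y ^ 2)) (by fun_prop),
        EuclideanSpace.volume_ball]
      simp
    _ = n * ENNReal.ofReal (√Real.pi ^ n / Real.Gamma (n / 2 + 1)) * (ENNReal.ofReal (1 / 2) *
        ∫⁻ t in Ioi (0 : ℝ), ENNReal.ofReal (t ^ ((n : ℝ) / 2 - 1)) * g t) := by
      rw [← lintegral_Ioi_comp_sq fun t ↦ ENNReal.ofReal (t ^ ((n : ℝ) / 2 - 1)) * g t,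
        ← lintegral_const_mul' _ _ ofReal_ne_top]
      congr 1
      refine setLIntegral_congr_fun measurableSet_Ioi fun y hy ↦ ?_
      have hy : 0 < y := hy
      have hpow : y ^ (n - 1) = 1 / 2 * (2 * y * (y ^ 2) ^ ((n : ℝ) / 2 - 1)) := by
        rw [← Real.rpow_natCast y 2, ← Real.rpow_mul hy.le, ← Real.rpow_natCast,
          Nat.cast_sub hn]
        have := Real.rpow_add hy 1 ((2 : ℕ) * ((n : ℝ) / 2 - 1))
        rw [Real.rpow_one] at this
        rw [mul_assoc 2, ← this]
        ring_nf
      simp only [hpow]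
      rw [ofReal_mul (by positivity), ofReal_mul (by positivity)]
      ring
    _ = _ := by
      rw [← mul_assoc, ← ofReal_natCast, ← ofReal_mul (by positivity),
        ← ofReal_mul (by positivity), Real.Gamma_add_one hn0.ne']
      congr 2
      have := (Real.Gamma_pos_of_pos hn0).ne'
      field_simp

/-- A positive definite matrix factors as `L * Lᵀ`, where the squared operator norm of `L` is
bounded by the largest eigenvalue. -/
lemma Matrix.PosDef.exists_mul_transpose_eq {ι : Type*} [Fintype ι] [DecidableEq ι]
    {S : Matrix ι ι ℝ} (hS : S.PosDef) {l : ℝ}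
    (hl : l ∈ upperBounds (range hS.isHermitian.eigenvalues)) :
    ∃ L : Matrix ι ι ℝ, L * Lᵀ = S ∧ ∀ z, L *ᵥ z ⬝ᵥ L *ᵥ z ≤ l * (z ⬝ᵥ z) := by
  set U : Matrix ι ι ℝ := (hS.isHermitian.eigenvectorUnitary : unitaryGroup ι ℝ).1
  set d := hS.isHermitian.eigenvalues
  have hd0 : ∀ i, 0 ≤ d i := fun i ↦ (hS.eigenvalues_pos i).le
  have hUU : Uᵀ * U = 1 := by
    simpa [star_eq_conjTranspose] using
      Unitary.coe_star_mul_self hS.isHermitian.eigenvectorUnitary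
  have hS' : S = U * diagonal d * Uᵀ := by
    have := hS.isHermitian.spectral_theorem
    rw [Unitary.conjStarAlgAut_apply] at this
    simpa [star_eq_conjTranspose, Function.comp_def] using this
  have hdiag : diagonal (fun i ↦ √(d i)) * diagonal (fun i ↦ √(d i)) = diagonal d := by
    simp [diagonal_mul_diagonal, Real.mul_self_sqrt, hd0]
  refine ⟨U * diagonal fun i ↦ √(d i), ?_, fun z ↦ ?_⟩
  · rw [transpose_mul, diagonal_transpose, hS', ← hdiag]
    simp only [Matrix.mul_assoc]
  · rw [dotProduct_mulVec, ← mulVec_transpose, mulVec_mulVec, transpose_mul, diagonal_transpose,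
      Matrix.mul_assoc, ← Matrix.mul_assoc Uᵀ, hUU, Matrix.one_mul, hdiag]
    simp only [dotProduct, mulVec_diagonal, Finset.mul_sum, mul_assoc]
    gcongr with i
    · exact mul_self_nonneg _
    · exact hl (mem_range_self i)

/-- The quadratic form of `(L * Lᵀ)⁻¹` at `L *ᵥ z` is the squared Euclidean norm of `z`. -/
lemma dotProduct_mul_transpose_inv_mulVec {ι : Type*} [Fintype ι] [DecidableEq ι]
    {L : Matrix ι ι ℝ} (hL : L.det ≠ 0) (z : ι → ℝ) :
    L *ᵥ z ⬝ᵥ (L * Lᵀ)⁻¹ *ᵥ (L *ᵥ z) = z ⬝ᵥ z := by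
  have hu : IsUnit L.det := hL.isUnit
  rw [Matrix.mul_inv_rev, mulVec_mulVec, Matrix.mul_assoc, nonsing_inv_mul _ hu, Matrix.mul_one,
    dotProduct_comm, dotProduct_mulVec, ← mulVec_transpose, mulVec_mulVec,
    mul_nonsing_inv _ (by rwa [det_transpose]), one_mulVec]

/-- Linear change of variables diagonalizing the quadratic form of `(L * Lᵀ)⁻¹`. -/
lemma lintegral_comp_dotProduct_inv_mulVec {n : ℕ} {L : Matrix (Fin n) (Fin n) ℝ}
    (hL : L.det ≠ 0) (μ : Fin n → ℝ) {g : ℝ → ℝ≥0∞} (hg : Measurable g) :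
    ∫⁻ x, g ((x - μ) ⬝ᵥ (L * Lᵀ)⁻¹ *ᵥ (x - μ)) =
      ENNReal.ofReal |L.det| * ∫⁻ z : Fin n → ℝ, g (z ⬝ᵥ z) := by
  have hquad := dotProduct_mul_transpose_inv_mulVec hL
  have hmeas : Measurable fun x : Fin n → ℝ ↦ g (x ⬝ᵥ (L * Lᵀ)⁻¹ *ᵥ x) :=
    hg.comp (by unfold mulVec dotProduct; fun_prop)
  have hmap := congrArg (fun ν ↦ ∫⁻ x, g (x ⬝ᵥ (L * Lᵀ)⁻¹ *ᵥ x) ∂ν)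
    (Real.map_matrix_volume_pi_eq_smul_volume_pi hL)
  simp only [lintegral_smul_measure, smul_eq_mul] at hmap
  rw [lintegral_map hmeas (by fun_prop)] at hmap
  simp only [toLin'_apply, hquad] at hmap
  rw [lintegral_sub_right_eq_self (fun x ↦ g (x ⬝ᵥ (L * Lᵀ)⁻¹ *ᵥ x)), hmap, ← mul_assoc,
    ← ofReal_mul (abs_nonneg _), ← abs_mul, mul_inv_cancel₀ hL]
  simp

/-- The squared Mahalanobis norm of a Gaussian vector is chi-squared distributed. -/
lemma multivariateGaussian_mahalanobis_le {n : ℕ} (hn : 1 ≤ n) {L : Matrix (Fin n) (Fin n) ℝ}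
    (hL : L.det ≠ 0) (μ : Fin n → ℝ) (q : ℝ) :
    multivariateGaussian μ (L * Lᵀ) {x | (x - μ) ⬝ᵥ (L * Lᵀ)⁻¹ *ᵥ (x - μ) ≤ q} =
      ProbabilityTheory.gammaMeasure (n / 2 : ℝ) (1 / 2) (Iic q) := by
  have hn0 : (0 : ℝ) < n / 2 := by positivity
  have hΓ := Real.Gamma_pos_of_pos hn0
  have hπ := Real.pi_pos
  set g : ℝ → ℝ≥0∞ := (Iic q).indicator fun t ↦ ENNReal.ofReal (Real.exp (-(1 / 2) * t)) with hg
  have hgm : Measurable g := Measurable.indicator (by fun_prop) measurableSet_Iic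
  have hset : MeasurableSet {x : Fin n → ℝ | (x - μ) ⬝ᵥ (L * Lᵀ)⁻¹ *ᵥ (x - μ) ≤ q} :=
    measurableSet_le (by unfold mulVec dotProduct; fun_prop) measurable_const
  have hsqrt : √((2 * Real.pi) ^ n * (L * Lᵀ).det) = √2 ^ n * √Real.pi ^ n * |L.det| := by
    rw [det_mul, det_transpose, Real.sqrt_mul (by positivity), Real.sqrt_mul_self_eq_abs,
      ← mul_pow, ← Real.sqrt_mul zero_le_two]
    congr 1
    rw [Real.sqrt_eq_iff_mul_self_eq (by positivity) (by positivity), ← mul_pow,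
      Real.mul_self_sqrt (by positivity)]
  have hhalf : (1 / 2 : ℝ) ^ ((n : ℝ) / 2) = (√2 ^ n)⁻¹ := by
    rw [Real.sqrt_eq_rpow, ← Real.rpow_natCast, ← Real.rpow_mul zero_le_two, one_div,
      Real.inv_rpow zero_le_two]
    ring_nf
  have hgauss : multivariateGaussian μ (L * Lᵀ) {x | (x - μ) ⬝ᵥ (L * Lᵀ)⁻¹ *ᵥ (x - μ) ≤ q} =
      ENNReal.ofReal (√2 ^ n * √Real.pi ^ n * |L.det|)⁻¹ *
        ∫⁻ x, g ((x - μ) ⬝ᵥ (L * Lᵀ)⁻¹ *ᵥ (x - μ)) := by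
    rw [multivariateGaussian, withDensity_apply _ hset, ← lintegral_indicator hset,
      ← lintegral_const_mul' _ _ ofReal_ne_top, hsqrt]
    refine lintegral_congr fun x ↦ ?_
    simp only [hg, indicator_apply, mem_ofPred_eq, mem_Iic]
    split_ifs
    · rw [ofReal_mul (by positivity)]
    · simp
  have hgamma : ProbabilityTheory.gammaMeasure (n / 2 : ℝ) (1 / 2) (Iic q) =
      ENNReal.ofReal ((√2 ^ n)⁻¹ / Real.Gamma (n / 2)) *
        ∫⁻ t in Ioi (0 : ℝ), ENNReal.ofReal (t ^ ((n : ℝ) / 2 - 1)) * g t := by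
    rw [ProbabilityTheory.gammaMeasure, withDensity_apply _ measurableSet_Iic,
      ← lintegral_const_mul' _ _ ofReal_ne_top, ← lintegral_indicator measurableSet_Iic,
      ← lintegral_indicator measurableSet_Ioi]
    refine lintegral_congr_ae ?_
    filter_upwards [Measure.ae_ne volume (0 : ℝ)] with t ht
    rcases ht.lt_or_gt with ht | ht
    · simp [indicator_apply, ProbabilityTheory.gammaPDF_of_neg ht, ht.not_gt]
    · simp only [hg, indicator_apply, mem_Iic, mem_Ioi, ht, if_true]
      split_ifs
      · rw [ProbabilityTheory.gammaPDF_of_nonneg ht.le, hhalf, ofReal_mul (by positivity),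
          ofReal_mul (by positivity), mul_assoc, neg_mul]
      · simp
  rw [hgauss, hgamma, lintegral_comp_dotProduct_inv_mulVec hL μ hgm,
    lintegral_comp_dotProduct_self hn hgm, ← mul_assoc, ← mul_assoc,
    ← ofReal_mul (by positivity), ← ofReal_mul (by positivity)]
  congr 2
  have := abs_pos.2 hL
  field_simp

end

/-- Gaussian norm quantile bound (probability form). If `ξ` is a Gaussian
random vector in `ℝⁿ` with mean `μ` and positive definite covariance `S` whose largest
eigenvalue is `lmax`, then for every `q ≥ 0`,
`P(‖ξ‖₂ ≤ ‖μ‖₂ + √(q·lmax)) ≥ P(χ²ₙ ≤ q)`, where `χ²ₙ` is the chi-squared distribution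
with `n` degrees of freedom, i.e. the Gamma distribution with shape `n/2` and rate `1/2`. -/
theorem gaussian_norm_quantile_bound
    {n : ℕ} (hn : 1 ≤ n)
    {Ω : Type*} [MeasurableSpace Ω] (P : Measure Ω) [IsProbabilityMeasure P]
    (ξ : Ω → (Fin n → ℝ)) (hξ : Measurable ξ)
    (μ : Fin n → ℝ) (S : Matrix (Fin n) (Fin n) ℝ) (hS : S.PosDef)
    (hlaw : P.map ξ = multivariateGaussian μ S)
    (lmax : ℝ) (hlmax : IsGreatest (Set.range hS.isHermitian.eigenvalues) lmax)
    (q : ℝ) (hq : 0 ≤ q) :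
    ProbabilityTheory.gammaMeasure (n / 2 : ℝ) (1 / 2) (Set.Iic q) ≤
      P {ω | Real.sqrt (ξ ω ⬝ᵥ ξ ω) ≤ Real.sqrt (μ ⬝ᵥ μ) + Real.sqrt (q * lmax)} := by
  obtain ⟨L, hLS, hLl⟩ := hS.exists_mul_transpose_eq hlmax.2
  have hL : L.det ≠ 0 := by
    intro h
    have := hS.det_pos
    simp [← hLS, det_mul, h] at this
  have hset : MeasurableSet
      {x : Fin n → ℝ | √(x ⬝ᵥ x) ≤ √(μ ⬝ᵥ μ) + √(q * lmax)} :=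
    measurableSet_le (by unfold dotProduct; fun_prop) measurable_const
  have hnorm (x : Fin n → ℝ) : √(x ⬝ᵥ x) = ‖WithLp.toLp 2 x‖ := by
    simp [EuclideanSpace.norm_eq, dotProduct, sq]
  calc
    _ = multivariateGaussian μ S {x | (x - μ) ⬝ᵥ S⁻¹ *ᵥ (x - μ) ≤ q} := by
      rw [← hLS, multivariateGaussian_mahalanobis_le hn hL]
    _ ≤ multivariateGaussian μ S {x | √(x ⬝ᵥ x) ≤ √(μ ⬝ᵥ μ) + √(q * lmax)} := by
      refine measure_mono fun x hx ↦ ?_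
      obtain ⟨z, hz⟩ : ∃ z, L *ᵥ z = x - μ :=
        ⟨L⁻¹ *ᵥ (x - μ), by rw [mulVec_mulVec, mul_nonsing_inv _ hL.isUnit, one_mulVec]⟩
      have hzq : z ⬝ᵥ z ≤ q := by
        rwa [Set.mem_ofPred_eq, ← hz, ← hLS, dotProduct_mul_transpose_inv_mulVec hL] at hx
      have hl0 : 0 ≤ lmax := by
        obtain ⟨i, rfl⟩ := hlmax.1
        exact (hS.eigenvalues_pos i).le
      have hdist : √((x - μ) ⬝ᵥ (x - μ)) ≤ √(q * lmax) := by
        rw [← hz, mul_comm q]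
        exact Real.sqrt_le_sqrt ((hLl z).trans (by gcongr))
      rw [hnorm, WithLp.toLp_sub] at hdist
      rw [Set.mem_ofPred_eq, hnorm, hnorm]
      linarith [norm_le_norm_add_norm_sub' (WithLp.toLp 2 x) (WithLp.toLp 2 μ)]
    _ = _ := by
      rw [← hlaw, Measure.map_apply hξ hset]
      rfl
end

section
/- Pointwise limit of the normalized log penalty. Define, for ε > 0, the function φ_{log,ε}(t) = log(1 + |t|/ε) on ℝ, and the normalization constant c(ε) = 1/φ_{log,ε}(1) = 1/log(1 + 1/ε). Then for every t ∈ ℝ, c(ε)·φ_{log,ε}(t) converges, as ε → 0⁺, to φ₀(t), where φ₀(t) = 1 if t ≠ 0 and φ₀(t) = 0 if t = 0. Equivalently: for every t ≠ 0, log(1 + |t|/ε)/log(1 + 1/ε) → 1 as ε → 0⁺, and for t = 0 the expression is identically 0. -/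
open Filter Topology

/-- Pointwise limit of the normalized log penalty. For `ε > 0` let
`φ_{log,ε}(t) = log (1 + |t|/ε)` and `c ε = 1 / log (1 + 1/ε)`. Then for every `t ∈ ℝ`,
`c ε * φ_{log,ε}(t)` converges, as `ε → 0⁺`, to `φ₀ t`, where `φ₀ t = 1` if `t ≠ 0`
and `φ₀ 0 = 0`. -/
theorem normalized_log_penalty_tendsto_l0
    (t : ℝ) :
    Tendsto (fun ε : ℝ => (Real.log (1 + 1 / ε))⁻¹ * Real.log (1 + |t| / ε))
      (𝓝[>] 0) (𝓝 (if t = 0 then 0 else 1)) := by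
  rcases eq_or_ne t 0 with rfl | ht
  · simp
  rw [if_neg ht]
  have ha : 0 < |t| := abs_pos.mpr ht
  have hlog : Tendsto (fun ε : ℝ => Real.log (1 + 1 / ε)) (𝓝[>] 0) atTop := by
    refine Real.tendsto_log_atTop.comp (tendsto_atTop_add_const_left _ 1 ?_)
    exact (tendsto_inv_nhdsGT_zero (𝕜 := ℝ)).congr fun ε => (one_div ε).symm
  have hdiff : Tendsto (fun ε : ℝ => Real.log (ε + |t|) - Real.log (ε + 1)) (𝓝[>] 0)
      (𝓝 (Real.log (0 + |t|) - Real.log (0 + 1))) := by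
    have hcont : ContinuousAt (fun ε : ℝ => Real.log (ε + |t|) - Real.log (ε + 1)) 0 :=
      ContinuousAt.sub (ContinuousAt.log (by fun_prop) (by simpa using ht))
        (ContinuousAt.log (by fun_prop) (by simp))
    exact hcont.tendsto.mono_left nhdsWithin_le_nhds
  have hlim := (hlog.inv_tendsto_atTop.mul hdiff).const_add 1
  rw [zero_mul, add_zero] at hlim
  refine hlim.congr' ?_
  filter_upwards [self_mem_nhdsWithin, hlog.eventually_gt_atTop 0] with ε hε hpos
  have hε : 0 < ε := hε
  have split_log (a : ℝ) (h : 0 < a) :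
      Real.log (1 + a / ε) = Real.log (ε + a) - Real.log ε := by
    rw [← Real.log_div (by positivity) hε.ne', add_div, div_self hε.ne']
  have hsplit : Real.log (1 + |t| / ε) =
      Real.log (1 + 1 / ε) + (Real.log (ε + |t|) - Real.log (ε + 1)) := by
    rw [split_log _ ha, split_log 1 one_pos]
    ring
  rw [hsplit, mul_add, inv_mul_cancel₀ hpos.ne', Pi.inv_apply]
end
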